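/- Let u be an infinite word over a finite alphabet whose language is closed under reversal. Then u is rich in palindromes if and only if every bispecial factor w of u satisfies: if w is non-palindromic then b(w) = 0, and if w is a palindrome then b(w) = #Pext(w) − 1. -/

import Mathlib

open List

/-- The factor of `u` of length `n` starting at position `i`. -/
def word {A : Type*} (u : ℕ → A) (i n : ℕ) : List A :=
  (List.range n).map (fun j => u (i + j))

/-- `w` occurs in `u` at position `i`. -/
def OccursAt {A : Type*} (u : ℕ → A) (w : List A) (i : ℕ) : Prop :=
  w = word u i w.length

/-- `w` is a factor of the infinite word `u`. -/
def IsFactor {A : Type*} (u : ℕ → A) (w : List A) : Prop :=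
  ∃ i, OccursAt u w i

/-- Every letter of the alphabet occurs in `u`. -/
def AllLettersOccur {A : Type*} (u : ℕ → A) : Prop :=
  ∀ a : A, ∃ i, u i = a

/-- The language of `u` is closed under reversal. -/
def ClosedUnderReversal {A : Type*} (u : ℕ → A) : Prop :=
  ∀ w : List A, IsFactor u w → IsFactor u w.reverse

/-- `u` is uniformly recurrent: every factor occurs in every window of some
bounded length. -/
def UniformlyRecurrent {A : Type*} (u : ℕ → A) : Prop :=
  ∀ w : List A, IsFactor u w → ∃ N : ℕ, ∀ i : ℕ, ∃ j : ℕ,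
    i ≤ j ∧ j < i + N ∧ OccursAt u w j

/-- Factor complexity: the number of factors of `u` of length `n`. -/
noncomputable def complexity {A : Type*} (u : ℕ → A) (n : ℕ) : ℕ :=
  Set.ncard {w : List A | w.length = n ∧ IsFactor u w}

/-- Palindromic complexity: the number of palindromic factors of `u` of
length `n`. -/
noncomputable def palComplexity {A : Type*} (u : ℕ → A) (n : ℕ) : ℕ :=
  Set.ncard {w : List A | w.length = n ∧ IsFactor u w ∧ w.reverse = w}

/-- The number of distinct palindromic factors of a finite word
(the empty word included). -/
noncomputable def palCount {A : Type*} (w : List A) : ℕ :=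
  Set.ncard {v : List A | v <:+: w ∧ v.reverse = v}

/-- `u` is rich in palindromes. -/
def Rich {A : Type*} (u : ℕ → A) : Prop :=
  ∀ w : List A, IsFactor u w → palCount w = w.length + 1

/-- `j < k` are two successive occurrences of `w` in `u`. -/
def SuccOccurrences {A : Type*} (u : ℕ → A) (w : List A) (j k : ℕ) : Prop :=
  OccursAt u w j ∧ OccursAt u w k ∧ j < k ∧
    ∀ l : ℕ, j < l → l < k → ¬ OccursAt u w l

/-- The set of return words of the factor `w` in `u`. -/
def returnWords {A : Type*} (u : ℕ → A) (w : List A) : Set (List A) :=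
  {v | ∃ j k : ℕ, SuccOccurrences u w j k ∧ v = word u j (k - j)}

/-- Left extensions of `w` in `u`. -/
def Lext {A : Type*} (u : ℕ → A) (w : List A) : Set A :=
  {a | IsFactor u (a :: w)}

/-- Right extensions of `w` in `u`. -/
def Rext {A : Type*} (u : ℕ → A) (w : List A) : Set A :=
  {b | IsFactor u (w ++ [b])}

/-- Bilateral extensions of `w` in `u`. -/
def Bext {A : Type*} (u : ℕ → A) (w : List A) : Set (A × A) :=
  {p | IsFactor u (p.1 :: (w ++ [p.2]))}

/-- Palindromic extensions of a (palindromic) factor `w` of `u`. -/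
def Pext {A : Type*} (u : ℕ → A) (w : List A) : Set (List A) :=
  {v | ∃ a : A, v = a :: (w ++ [a]) ∧ IsFactor u v}

/-- `w` is a bispecial factor of `u`. -/
def Bispecial {A : Type*} (u : ℕ → A) (w : List A) : Prop :=
  IsFactor u w ∧ 2 ≤ Set.ncard (Lext u w) ∧ 2 ≤ Set.ncard (Rext u w)

/-- The bilateral order of a factor `w` of `u`. -/
noncomputable def bilateralOrder {A : Type*} (u : ℕ → A) (w : List A) : ℤ :=
  (Set.ncard (Bext u w) : ℤ) - Set.ncard (Rext u w) - Set.ncard (Lext u w) + 1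

/-- `u` is eventually periodic. -/
def EventuallyPeriodic {A : Type*} (u : ℕ → A) : Prop :=
  ∃ p : ℕ, 0 < p ∧ ∃ N : ℕ, ∀ n : ℕ, N ≤ n → u (n + p) = u n

/-- `u` is aperiodic. -/
def Aperiodic {A : Type*} (u : ℕ → A) : Prop :=
  ¬ EventuallyPeriodic u

/-- `u` is (1-)balanced. -/
def IsBalanced {A : Type*} [DecidableEq A] (u : ℕ → A) : Prop :=
  ∀ a : A, ∀ w v : List A, IsFactor u w → IsFactor u v → w.length = v.length →
    |(w.count a : ℤ) - (v.count a : ℤ)| ≤ 1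


section Positions

variable {A : Type*} (u : ℕ → A)

/-- equality of length-`n` windows -/
def WE (n i j : ℕ) : Prop := ∀ k, k < n → u (i + k) = u (j + k)
/-- mirror equality of length-`n` windows -/
def WR (n i j : ℕ) : Prop := ∀ k l, k + l + 1 = n → u (i + k) = u (j + l)
/-- equality up to mirror of windows -/
def WS (n i j : ℕ) : Prop := WE u n i j ∨ WR u n i j
/-- `t` is the first position where the class of its window is visited -/
def Fst (n t : ℕ) : Prop := ∀ s, s < t → ¬ WS u n s t

variable {u}

lemma WE.refl (n i : ℕ) : WE u n i i := fun _ _ => rfl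
lemma WE.symm {n i j : ℕ} (h : WE u n i j) : WE u n j i := fun k hk => (h k hk).symm
lemma WE.trans {n i j l : ℕ} (h : WE u n i j) (h' : WE u n j l) : WE u n i l :=
  fun k hk => (h k hk).trans (h' k hk)
lemma WR.symm {n i j : ℕ} (h : WR u n i j) : WR u n j i :=
  fun k l hk => (h l k (by omega)).symm
lemma WR.trans {n i j l : ℕ} (h : WR u n i j) (h' : WR u n j l) : WE u n i l :=
  fun k hk => (h k (n - 1 - k) (by omega)).trans (h' _ k (by omega))
lemma WE.transR {n i j l : ℕ} (h : WE u n i j) (h' : WR u n j l) : WR u n i l :=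
  fun k m hk => (h k (by omega)).trans (h' k m (by omega))
lemma WR.transE {n i j l : ℕ} (h : WR u n i j) (h' : WE u n j l) : WR u n i l :=
  fun k m hk => (h k m (by omega)).trans (h' m (by omega))
lemma WS.refl (n i : ℕ) : WS u n i i := Or.inl (WE.refl n i)
lemma WS.symm {n i j : ℕ} (h : WS u n i j) : WS u n j i := h.imp WE.symm WR.symm
lemma WS.trans {n i j l : ℕ} (h : WS u n i j) (h' : WS u n j l) : WS u n i l := by
  rcases h with h | h <;> rcases h' with h' | h'
  · exact Or.inl (h.trans h')
  · exact Or.inr (h.transR h')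
  · exact Or.inr (h.transE h')
  · exact Or.inl (h.trans h')
lemma WE.sub {n i j m d : ℕ} (h : WE u n i j) (hm : d + m ≤ n) : WE u m (i + d) (j + d) :=
  fun k hk => by have := h (d + k) (by omega); rwa [← add_assoc, ← add_assoc] at this
lemma WR.sub {n i j m d e : ℕ} (h : WR u n i j) (hm : d + m + e = n) :
    WR u m (i + d) (j + e) :=
  fun k l hk => by
    have := h (d + k) (e + l) (by omega); rwa [← add_assoc, ← add_assoc] at this

/-- A window equal up to mirror at length `n+1` relates ends. -/
lemma WS.ends {n i j : ℕ} (h : WS u (n + 1) i j) :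
    (WS u n i j ∧ WS u n (i + 1) (j + 1)) ∨ (WS u n i (j + 1) ∧ WS u n (i + 1) j) := by
  rcases h with h | h
  · left
    exact ⟨Or.inl (h.sub (d := 0) (by omega)), Or.inl (h.sub (d := 1) (by omega))⟩
  · right
    exact ⟨Or.inr (h.sub (d := 0) (e := 1) (by omega)),
      Or.inr (h.sub (d := 1) (e := 0) (by omega))⟩

lemma Fst.pred {n t : ℕ} (h : Fst u n (t + 1)) : Fst u (n + 1) t ∧ ¬ WR u (n + 1) t t := by
  constructor
  · intro s hs hS
    rcases hS.ends with ⟨_, h2⟩ | ⟨h1, _⟩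
    · exact h _ (by omega) h2
    · exact h _ (by omega) h1
  · intro hR
    exact h t (by omega) (Or.inr (hR.sub (d := 0) (e := 1) (by omega)))

/-- last element below a bound -/
lemma exists_last {p : ℕ → Prop} {s t : ℕ} (hs : s < t) (h : p s) :
    ∃ r, s ≤ r ∧ r < t ∧ p r ∧ ∀ l, r < l → l < t → ¬ p l := by
  classical
  induction t with
  | zero => omega
  | succ t ih =>
    by_cases hp : p t
    · exact ⟨t, by omega, by omega, hp, fun l h1 h2 => by omega⟩
    · have : s < t := by
        rcases Nat.lt_succ_iff_lt_or_eq.mp hs with h1 | h1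
        · exact h1
        · subst h1; exact absurd h hp
      obtain ⟨r, h1, h2, h3, h4⟩ := ih this
      refine ⟨r, h1, by omega, h3, fun l h5 h6 => ?_⟩
      rcases Nat.lt_succ_iff_lt_or_eq.mp h6 with h7 | h7
      · exact h4 l h5 h7
      · subst h7; exact hp

variable (u)
/-- Complete mirror returns are palindromes. -/
def PalRet : Prop := ∀ n s t, s < t → WS u n s t → (∀ l, s < l → l < t → ¬ WS u n s l) →
  WR u (t - s + n) s s

/-- New edges enter new vertices. -/
def NewEdge : Prop := ∀ n t, Fst u (n + 1) t → ¬ WR u (n + 1) t t → Fst u n (t + 1)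

variable {u}

lemma PalRet.newEdge (h : PalRet u) : NewEdge u := by
  intro n t hF hP s hs hS
  obtain ⟨r, _, hrt, hr, hlast⟩ := exists_last (p := fun s => WS u n s (t + 1)) hs hS
  have := h n r (t + 1) hrt hr (fun l h1 h2 h3 => hlast l h1 h2 (h3.symm.trans hr))
  rcases Nat.lt_succ_iff_lt_or_eq.mp hrt with h1 | h1
  · refine hF r h1 (Or.inr ?_)
    have h2 := this.sub (m := n + 1) (d := 0) (e := t - r) (by omega)
    rwa [add_zero, show r + (t - r) = t by omega] at h2
  · subst h1
    exact hP (by rwa [show r + 1 - r + n = n + 1 by omega] at this)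

open Classical in
/-- first visit time of the class -/
noncomputable def tau (u : ℕ → A) (n i : ℕ) : ℕ :=
  Nat.find (p := fun r => WS u n r i) ⟨i, WS.refl n i⟩

lemma tau_spec (n i : ℕ) : WS u n (tau u n i) i := by
  classical
  exact Nat.find_spec (p := fun r => WS u n r i) ⟨i, WS.refl n i⟩

lemma tau_le {n i r : ℕ} (h : WS u n r i) : tau u n i ≤ r := by
  classical
  exact Nat.find_min' (p := fun r => WS u n r i) ⟨i, WS.refl n i⟩ h

lemma tau_eq {n i j : ℕ} (h : WS u n i j) : tau u n i = tau u n j :=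
  le_antisymm (tau_le ((tau_spec n j).trans h.symm)) (tau_le ((tau_spec n i).trans h))

lemma tau_eq_iff {n i j : ℕ} : tau u n i = tau u n j ↔ WS u n i j := by
  refine ⟨fun h => ?_, tau_eq⟩
  have := tau_spec (u := u) n i
  rw [h] at this
  exact this.symm.trans (tau_spec n j)

lemma fst_tau (n i : ℕ) : Fst u n (tau u n i) := by
  intro s hs h
  have := tau_le (h.trans (tau_spec n i))
  omega

lemma Fst.tau {n t : ℕ} (h : Fst u n t) : tau u n t = t := by
  by_contra hne
  exact h _ (lt_of_le_of_ne (tau_le (WS.refl n t)) hne) (tau_spec n t)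

lemma NewEdge.step (h : NewEdge u) (n i : ℕ) :
    WR u (n + 1) i i ∧ tau u n i = tau u n (i + 1) ∨
    (∃ r, WS u (n + 1) r i ∧
      (tau u n (i + 1) = r + 1 ∧ tau u n i = tau u n r ∨
       tau u n i = r + 1 ∧ tau u n (i + 1) = tau u n r)) := by
  by_cases hp : WR u (n + 1) i i
  · exact Or.inl ⟨hp, tau_eq (Or.inr (hp.sub (d := 0) (e := 1) (by omega)))⟩
  · right
    refine ⟨tau u (n + 1) i, tau_spec _ _, ?_⟩
    have hs := tau_spec (u := u) (n + 1) i
    have hf := fst_tau (u := u) (n + 1) i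
    set r := tau u (n + 1) i with hr
    have hrp : ¬ WR u (n + 1) r r := by
      intro hrp
      apply hp
      rcases hs with hs | hs
      · exact hs.symm.transR (hrp.transE hs)
      · exact hs.symm.transE (hrp.trans hs)
    have := (h n r hf hrp).tau
    rcases hs.ends with ⟨h1, h2⟩ | ⟨h1, h2⟩
    · left; exact ⟨by rw [← tau_eq h2, this], (tau_eq h1).symm⟩
    · right; exact ⟨by rw [← tau_eq h2, this], (tau_eq h1).symm⟩

/-- abstract tree lemma: along a walk avoiding `r`, being a descendant of a child of `r`
is invariant -/
lemma tree_inv (par : ℕ → ℕ) (x : ℕ → ℕ) (r c a b : ℕ)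
    (hc : par c = r) (hab : a ≤ b)
    (hx : ∀ i, a ≤ i → i ≤ b → x i ≠ r)
    (hstep : ∀ i, x i = x (i + 1) ∨ par (x (i + 1)) = x i ∨ par (x i) = x (i + 1)) :
    (∃ j, par^[j] (x a) = c) ↔ (∃ j, par^[j] (x b) = c) := by
  have key : ∀ y z, y ≠ r → z ≠ r → par z = y →
      ((∃ j, par^[j] y = c) ↔ (∃ j, par^[j] z = c)) := by
    intro y z hy hz h
    constructor
    · rintro ⟨j, hj⟩
      exact ⟨j + 1, by rw [Function.iterate_succ_apply, h, hj]⟩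
    · rintro ⟨j, hj⟩
      cases j with
      | zero =>
        simp only [Function.iterate_zero, id_eq] at hj
        subst hj
        exact absurd (h.symm.trans hc) hy
      | succ j => exact ⟨j, by rw [Function.iterate_succ_apply, h] at hj; exact hj⟩
  induction b, hab using Nat.le_induction with
  | base => exact Iff.rfl
  | succ b hab ih =>
    refine (ih (fun i h1 h2 => hx i h1 (by omega))).trans ?_
    have h1 := hx b hab (by omega)
    have h2 := hx (b + 1) (by omega) le_rfl
    rcases hstep b with h | h | h
    · rw [h]
    · exact key _ _ h1 h2 h
    · exact (key _ _ h2 h1 h).symm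

lemma tree_ret (par : ℕ → ℕ) (hpar : ∀ y, par y ≤ y)
    (r c d : ℕ) (hcr : r < c)
    (hd : d = r ∨ par d = r ∨ par r = d) (hD : ∃ j, par^[j] d = c) : c = d := by
  have hit : ∀ j y, par^[j] y ≤ y := by
    intro j
    induction j with
    | zero => intro y; simp
    | succ j ih => intro y; rw [Function.iterate_succ_apply]; exact (ih _).trans (hpar y)
  obtain ⟨j, hj⟩ := hD
  rcases hd with h | h | h
  · subst h; have := hit j d; omega
  · cases j with
    | zero => simpa using hj.symm
    | succ j =>
      rw [Function.iterate_succ_apply, h] at hj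
      have := hit j r; omega
  · have := hit j d; have := hpar r; omega

lemma NewEdge.firstStep (h : NewEdge u) {n s t : ℕ} (hst : s < t) (hS : WS u n s t)
    (hno : ∀ l, s < l → l < t → ¬ WS u n s l) : WR u (n + 1) s (t - 1) := by
  set par : ℕ → ℕ := fun y => tau u n (y - 1) with hpardef
  have hpar : ∀ y, par y ≤ y := fun y => by
    have := tau_le (WS.refl (u := u) n (y - 1)); simp only [hpardef]; omega
  have hpar' : ∀ y, 0 < y → par y < y := fun y hy => by
    have := tau_le (WS.refl (u := u) n (y - 1)); simp only [hpardef]; omega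
  have hstep : ∀ i, tau u n i = tau u n (i + 1) ∨ par (tau u n (i + 1)) = tau u n i ∨
      par (tau u n i) = tau u n (i + 1) := by
    intro i
    rcases h.step n i with ⟨_, h1⟩ | ⟨r, _, ⟨h1, h2⟩ | ⟨h1, h2⟩⟩
    · exact Or.inl h1
    · right; left; rw [h1, h2]; simp [hpardef]
    · right; right; rw [h1, h2]; simp [hpardef]
  rcases Nat.lt_or_ge (s + 1) t with hk | hk
  swap
  · have : t = s + 1 := by omega
    subst this
    rw [Nat.add_sub_cancel]
    have he := tau_eq hS
    rcases h.step n s with ⟨h1, _⟩ | ⟨r, _, ⟨h1, h2⟩ | ⟨h1, h2⟩⟩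
    · exact h1
    · have := tau_le (WS.refl (u := u) n r); omega
    · have := tau_le (WS.refl (u := u) n r); omega
  · have hx : ∀ i, s + 1 ≤ i → i ≤ t - 1 → tau u n i ≠ tau u n s := by
      intro i h1 h2 h3
      exact hno i (by omega) (by omega) (tau_eq_iff.mp h3.symm)
    have hrt := tau_eq hS
    have ht1 : t - 1 + 1 = t := by omega
    have e1 := hstep s
    have e2 := hstep (t - 1)
    rw [ht1, ← hrt] at e2
    have n1 := hx (s + 1) le_rfl (by omega)
    have n2 := hx (t - 1) (by omega) le_rfl
    have hcc : tau u n (s + 1) = tau u n (t - 1) := by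
      rcases Nat.lt_or_ge (tau u n s) (tau u n (s + 1)) with h1 | h1
      · have hc : par (tau u n (s + 1)) = tau u n s := by
          rcases e1 with e | e | e
          · exact absurd e.symm n1
          · exact e
          · have := hpar (tau u n s); omega
        have := (tree_inv par (tau u n) (tau u n s) _ (s + 1) (t - 1) hc (by omega) hx hstep).mp
          ⟨0, rfl⟩
        refine tree_ret par hpar (tau u n s) _ _ h1 ?_ this
        rcases e2 with e | e | e
        · exact Or.inl e
        · exact Or.inr (Or.inr e)
        · exact Or.inr (Or.inl e)
      · rcases Nat.lt_or_ge (tau u n s) (tau u n (t - 1)) with h2 | h2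
        · have hc : par (tau u n (t - 1)) = tau u n s := by
            rcases e2 with e | e | e
            · exact absurd e n2
            · have := hpar (tau u n s); omega
            · exact e
          have := (tree_inv par (tau u n) (tau u n s) _ (s + 1) (t - 1) hc (by omega) hx hstep).mpr
            ⟨0, rfl⟩
          refine (tree_ret par hpar (tau u n s) _ _ h2 ?_ this).symm
          rcases e1 with e | e | e
          · exact Or.inl e.symm
          · exact Or.inr (Or.inl e)
          · exact Or.inr (Or.inr e)
        · have a1 : par (tau u n s) = tau u n (s + 1) := by
            rcases e1 with e | e | e
            · exact absurd e.symm n1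
            · have := hpar' (tau u n (s + 1)); have := hpar (tau u n (s+1)); omega
            · exact e
          have a2 : par (tau u n s) = tau u n (t - 1) := by
            rcases e2 with e | e | e
            · exact absurd e n2
            · exact e
            · have := hpar (tau u n (t - 1)); omega
          rw [← a1, a2]
    have hW : WS u (n + 1) s (t - 1) := by
      rcases h.step n s with ⟨_, h1⟩ | ⟨r, hr, h1⟩
      · exact absurd h1.symm n1
      rcases h.step n (t - 1) with ⟨_, h2⟩ | ⟨r', hr', h2⟩
      · rw [ht1, ← hrt] at h2; exact absurd h2 n2
      rw [ht1, ← hrt] at h2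
      have l1 := tau_le (WS.refl (u := u) n r)
      have l2 := tau_le (WS.refl (u := u) n r')
      have : r = r' := by omega
      subst this
      exact hr.symm.trans hr'
    rcases hW with hW | hW
    · exact absurd (tau_eq (Or.inl (hW.sub (d := 0) (m := n) (by omega)))).symm n2
    · exact hW

/-- complete returns to palindromes are palindromes -/
lemma NewEdge.palRet (h : NewEdge u) {n s t : ℕ} (hst : s < t) (hP : WR u n s s)
    (hS : WE u n s t) (hno : ∀ l, s < l → l < t → ¬ WE u n s l) :
    WR u (t - s + n) s s := by
  classical
  by_contra hcon
  have hex : ∃ i, i < t - s + n ∧ u (s + i) ≠ u (t + n - 1 - i) := by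
    by_contra hall
    push Not at hall
    apply hcon
    intro k l hkl
    rw [hall k (by omega)]
    congr 1; omega
  obtain ⟨m, ⟨hm, hne⟩, hmin⟩ : ∃ m, (m < t - s + n ∧ u (s + m) ≠ u (t + n - 1 - m)) ∧
      ∀ i, i < m → u (s + i) = u (t + n - 1 - i) := by
    refine ⟨Nat.find hex, Nat.find_spec hex, fun i hi => ?_⟩
    have := Nat.find_min hex hi
    have h2 := (Nat.find_spec hex).1
    by_contra h3
    exact this ⟨by omega, h3⟩
  have hnm : n ≤ m := by
    by_contra hlt
    apply hne
    have h1 := hP m (n - 1 - m) (by omega)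
    have h2 := hS (n - 1 - m) (by omega)
    rw [h1, h2]; congr 1; omega
  have h2m : 2 * m + 1 < t - s + n := by
    by_contra hlt
    apply hne
    by_cases he : s + m = t + n - 1 - m
    · rw [← he]
    · have := hmin (t - s + n - 1 - m) (by omega)
      rw [show s + (t - s + n - 1 - m) = t + n - 1 - m by omega,
        show t + n - 1 - (t - s + n - 1 - m) = s + m by omega] at this
      exact this.symm
  have hx : WR u m s (t + n - m) := by
    intro k l hkl
    rw [hmin k (by omega)]; congr 1; omega
  have := h.firstStep (n := m) (s := s) (t := t + n - m) (by omega) (Or.inr hx) (by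
    intro l h1 h2 h3
    rcases h3 with h3 | h3
    · exact hno l h1 (by omega) (h3.sub (d := 0) (by omega))
    · have h4 := h3.sub (m := n) (d := 0) (e := m - n) (by omega)
      exact hno (l + (m - n)) (by omega) (by omega) (hP.trans h4))
  have := this m 0 (by omega)
  apply hne
  rw [this]; congr 1; omega

end Positions

section Words

variable {A : Type*} {u : ℕ → A}

@[simp] lemma word_length (i n : ℕ) : (word u i n).length = n := by simp [word]

lemma word_getElem (i n k : ℕ) (h : k < (word u i n).length) : (word u i n)[k] = u (i + k) := by
  simp [word]

lemma word_eq_iff {n i j : ℕ} : word u i n = word u j n ↔ WE u n i j := by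
  constructor
  · intro h k hk
    have h1 : (word u i n)[k]'(by simpa using hk) = (word u j n)[k]'(by simpa using hk) := by
      simp only [h]
    simpa [word_getElem] using h1
  · intro h
    apply List.ext_getElem (by simp)
    intro k h1 h2
    rw [word_getElem, word_getElem]
    exact h k (by simpa using h1)

lemma word_rev_iff {n i j : ℕ} : (word u i n).reverse = word u j n ↔ WR u n i j := by
  constructor
  · intro h k l hk
    have h1 : ((word u i n).reverse)[l]'(by simp; omega) =
      (word u j n)[l]'(by simp; omega) := by simp only [h]
    rw [List.getElem_reverse, word_getElem, word_getElem] at h1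
    rw [← h1]; congr 1; simp; omega
  · intro h
    apply List.ext_getElem (by simp)
    intro k h1 h2
    rw [List.getElem_reverse, word_getElem, word_getElem]
    simp only [word_length] at h2 ⊢
    exact h _ _ (by omega)

lemma word_add (i m k : ℕ) : word u i (m + k) = word u i m ++ word u (i + m) k := by
  simp [word, List.range_add, Function.comp_def, add_assoc]

lemma isFactor_word (i n : ℕ) : IsFactor u (word u i n) := ⟨i, by simp [OccursAt]⟩

lemma isFactor_iff {w : List A} : IsFactor u w ↔ ∃ i, w = word u i w.length := Iff.rfl

lemma infix_word_iff {v : List A} {i L : ℕ} :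
    v <:+: word u i L ↔ ∃ j m, i ≤ j ∧ j + m ≤ i + L ∧ v = word u j m := by
  constructor
  · rintro ⟨s, t, h⟩
    have hl := congrArg List.length h
    simp at hl
    refine ⟨i + s.length, v.length, by omega, by omega, ?_⟩
    have : word u i L = word u i s.length ++ word u (i + s.length) v.length ++
        word u (i + s.length + v.length) t.length := by
      rw [← hl, ← add_assoc, word_add, word_add, add_assoc]
    rw [this] at h
    have h1 := List.append_inj h (by simp)
    exact (List.append_inj h1.1 (by simp)).2
  · rintro ⟨j, m, h1, h2, rfl⟩
    refine ⟨word u i (j - i), word u (j + m) (i + L - (j + m)), ?_⟩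
    rw [show L = (j - i) + m + (i + L - (j + m)) by omega, word_add, word_add,
      show i + (j - i) = j by omega, show i + (j - i + m) = j + m by omega]
    congr 2; omega

/-- palindromic factors of a finite word -/
def palSet (w : List A) : Set (List A) := {v : List A | v <:+: w ∧ v.reverse = v}

lemma palSet_finite (w : List A) : (palSet w).Finite :=
  (List.finite_toSet w.sublists).subset (fun v hv => by
    simpa using hv.1.sublist)

lemma palSet_mono {i L : ℕ} : palSet (word u i L) ⊆ palSet (word u i (L + 1)) := by
  rintro v ⟨h1, h2⟩
  exact ⟨h1.trans (infix_word_iff.mpr ⟨i, L, le_rfl, by omega, rfl⟩), h2⟩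

lemma Rich.newPal (h : Rich u) (i L : ℕ) : ∃ j m, i ≤ j ∧ j + m = i + L + 1 ∧
    WR u m j j ∧ ∀ k, i ≤ k → k + m ≤ i + L → ¬ WE u m k j := by
  have h1 : (palSet (word u i L)).ncard = L + 1 :=
    (h _ (isFactor_word i L)).trans (by simp)
  have h2 : (palSet (word u i (L + 1))).ncard = L + 1 + 1 :=
    (h _ (isFactor_word i (L + 1))).trans (by simp)
  have : ∃ v ∈ palSet (word u i (L + 1)), v ∉ palSet (word u i L) := by
    by_contra hcon
    push Not at hcon
    have := Set.ncard_le_ncard (s := palSet (word u i (L + 1))) hcon (palSet_finite _)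
    omega
  obtain ⟨v, ⟨hv1, hv2⟩, hv3⟩ := this
  obtain ⟨j, m, hj, hm, rfl⟩ := infix_word_iff.mp hv1
  have hno : ∀ k, i ≤ k → k + m ≤ i + L → ¬ WE u m k j := by
    intro k hk hkm hE
    exact hv3 ⟨infix_word_iff.mpr ⟨k, m, hk, hkm, (word_eq_iff.mpr hE).symm⟩, hv2⟩
  refine ⟨j, m, hj, ?_, word_rev_iff.mp hv2, hno⟩
  by_contra hne
  exact hno j hj (by omega) (WE.refl _ _)

lemma Rich.palRet (h : Rich u) : PalRet u := by
  intro n s t hst hS hno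
  obtain ⟨j, m, hj, hm, hP, hnew⟩ := h.newPal s (t - s + n - 1)
  rcases Nat.lt_or_ge n m with hnm | hnm
  · rcases Nat.eq_or_lt_of_le hj with he | hl
    · subst he
      rwa [show m = t - s + n by omega] at hP
    · have h1 : WR u n (j + 0) (j + (m - n)) := hP.sub (by omega)
      rw [show j + (m - n) = t by omega] at h1
      exact absurd (hS.trans (Or.inr h1.symm)) (hno j hl (by omega))
  · exfalso
    -- suffix of the window at t
    rcases hS with hS | hS
    · have h1 : WE u m (s + (n - m)) (t + (n - m)) := hS.sub (by omega)
      rw [show t + (n - m) = j by omega] at h1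
      exact hnew _ (by omega) (by omega) h1
    · have h1 : WR u m (s + 0) (t + (n - m)) := hS.sub (by omega)
      rw [show t + (n - m) = j by omega] at h1
      exact hnew s (by omega) (by omega) (h1.trans hP)

lemma NewEdge.rich (h : NewEdge u) : Rich u := by
  classical
  have key : ∀ i L, (palSet (word u i L)).ncard = L + 1 := by
    intro i L
    induction L with
    | zero =>
      have : palSet (word u i 0) = {[]} := by
        ext v; simp only [palSet, word, List.range_zero, List.map_nil, Set.mem_ofPred_eq,
          Set.mem_singleton_iff, List.infix_nil]
        constructor
        · exact fun h => h.1
        · rintro rfl; simp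
      rw [this]; simp
    | succ L ih =>
      have hex : ∃ j, i ≤ j ∧ j ≤ i + L ∧ WR u (i + L + 1 - j) j j :=
        ⟨i + L, by omega, le_rfl, fun k l hkl => by
          rw [show k = l by omega]⟩
      obtain ⟨j, ⟨hj1, hj2, hjP⟩, hmin⟩ : ∃ j, (i ≤ j ∧ j ≤ i + L ∧ WR u (i + L + 1 - j) j j) ∧
          ∀ k, k < j → i ≤ k → ¬ WR u (i + L + 1 - k) k k := by
        refine ⟨Nat.find hex, Nat.find_spec hex, fun k hk hik hW => ?_⟩
        have := (Nat.find_spec hex).2.1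
        exact Nat.find_min hex hk ⟨hik, by omega, hW⟩
      set m := i + L + 1 - j with hm
      have heq : palSet (word u i (L + 1)) = insert (word u j m) (palSet (word u i L)) := by
        apply Set.Subset.antisymm
        · rintro v ⟨hv1, hv2⟩
          obtain ⟨j', m', h1, h2, rfl⟩ := infix_word_iff.mp hv1
          rcases Nat.lt_or_ge (j' + m') (i + L + 1) with h3 | h3
          · exact Or.inr ⟨infix_word_iff.mpr ⟨j', m', h1, by omega, rfl⟩, hv2⟩
          · have hm' : m' = i + L + 1 - j' := by omega
            have hP := word_rev_iff.mp hv2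
            rcases Nat.lt_trichotomy j' j with h4 | h4 | h4
            · rw [hm'] at hP
              exact absurd hP (hmin j' h4 h1)
            · subst h4; left; rw [hm']
            · right
              refine ⟨infix_word_iff.mpr ⟨j, m', hj1, by omega, ?_⟩, hv2⟩
              rw [word_eq_iff]
              have h5 : WR u m' (j + 0) (j + (m - m')) := hjP.sub (by omega)
              rw [show j + (m - m') = j' by omega] at h5
              exact hP.trans h5.symm
        · intro v hv
          rcases hv with rfl | hv
          · exact ⟨infix_word_iff.mpr ⟨j, m, hj1, by omega, rfl⟩, word_rev_iff.mpr hjP⟩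
          · exact palSet_mono hv
      rw [heq, Set.ncard_insert_of_notMem _ (palSet_finite _), ih]
      rintro ⟨hv, _⟩
      obtain ⟨k, m', hk1, hk2, hk3⟩ := infix_word_iff.mp hv
      have hmm : m = m' := by simpa using congrArg List.length hk3
      subst hmm
      rw [word_eq_iff] at hk3
      obtain ⟨r, hr1, hr2, hr3, hr4⟩ := exists_last (p := fun k => WE u m k j) (s := k) (t := j)
        (by omega) hk3.symm
      have := h.palRet (n := m) (s := r) (t := j) hr2 (hr3.transR (hjP.transE hr3.symm)) hr3
        (fun l h1 h2 h3 => hr4 l h1 h2 (h3.symm.trans hr3))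
      apply hmin r hr2 (by omega)
      rwa [show j - r + m = i + L + 1 - r by omega] at this
  intro w hw
  obtain ⟨i, hi⟩ := hw
  rw [OccursAt] at hi
  have := key i w.length
  rw [← hi] at this
  exact this

end Words

section Counting

variable {A : Type*} {u : ℕ → A}

lemma factors_finite [Finite A] (u : ℕ → A) (n : ℕ) :
    {w : List A | w.length = n ∧ IsFactor u w}.Finite :=
  (List.finite_length_eq A n).subset (fun _ h => h.1)

lemma Fst.inj {n s t : ℕ} (hs : Fst u n s) (ht : Fst u n t) (h : WS u n s t) : s = t := by
  rcases Nat.lt_trichotomy s t with h1 | h1 | h1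
  · exact absurd h (ht s h1)
  · exact h1
  · exact absurd h.symm (hs t h1)

lemma fst_finite [Finite A] (u : ℕ → A) (n : ℕ) : {t | Fst u n t}.Finite := by
  refine Set.Finite.of_finite_image (f := fun t => word u t n)
    ((factors_finite u n).subset ?_) ?_
  · rintro _ ⟨t, _, rfl⟩
    exact ⟨by simp, isFactor_word _ _⟩
  · intro s hs t ht h
    exact Fst.inj hs ht (Or.inl (word_eq_iff.mp h))

lemma palComplexity_eq (n : ℕ) :
    palComplexity u n = {t | Fst u n t ∧ WR u n t t}.ncard := by
  rw [palComplexity, ← Set.InjOn.ncard_image (f := fun t => word u t n)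
    (s := {t | Fst u n t ∧ WR u n t t})]
  · congr 1
    ext w
    constructor
    · rintro ⟨rfl, ⟨i, hi⟩, h⟩
      rw [OccursAt] at hi
      have hP : WR u w.length i i := by
        apply word_rev_iff.mp; rw [← hi, h]
      have hE : WE u w.length (tau u w.length i) i := by
        rcases tau_spec (u := u) w.length i with h1 | h1
        · exact h1
        · exact h1.trans hP
      refine ⟨tau u w.length i, ⟨fst_tau _ _, hE.transR (hP.transE hE.symm)⟩, ?_⟩
      exact (word_eq_iff.mpr hE).trans hi.symm
    · rintro ⟨t, ⟨_, h2⟩, rfl⟩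
      exact ⟨by simp, isFactor_word _ _, word_rev_iff.mpr h2⟩
  · intro s hs t ht h
    exact Fst.inj hs.1 ht.1 (Or.inl (word_eq_iff.mp h))

lemma fst_ncard [Finite A] (u : ℕ → A) (n : ℕ) : {t | Fst u n t}.ncard =
    {t | Fst u n t ∧ WR u n t t}.ncard + {t | Fst u n t ∧ ¬ WR u n t t}.ncard := by
  rw [← Set.ncard_union_eq ?_ ((fst_finite u n).subset (fun t h => h.1))
    ((fst_finite u n).subset (fun t h => h.1))]
  · congr 1; ext t
    by_cases h : WR u n t t <;> simp [h]
  · rw [Set.disjoint_left]; rintro t ⟨_, h⟩ ⟨_, h'⟩; exact h' h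

lemma complexity_eq [Finite A] (hcur : ClosedUnderReversal u) (n : ℕ) :
    complexity u n = {t | Fst u n t}.ncard + {t | Fst u n t ∧ ¬ WR u n t t}.ncard := by
  rw [complexity, ← Set.InjOn.ncard_image (f := fun t => word u t n)
    (s := {t | Fst u n t}), ← Set.InjOn.ncard_image (f := fun t => (word u t n).reverse)
    (s := {t | Fst u n t ∧ ¬ WR u n t t}), ← Set.ncard_union_eq ?_
    ((fst_finite u n).image _) (Set.Finite.image _ ((fst_finite u n).subset (fun t h => h.1)))]
  · congr 1
    ext w
    constructor
    · rintro ⟨rfl, i, hi⟩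
      rw [OccursAt] at hi
      rcases tau_spec (u := u) w.length i with h1 | h1
      · exact Or.inl ⟨tau u w.length i, fst_tau _ _, (word_eq_iff.mpr h1).trans hi.symm⟩
      · by_cases hP : WR u w.length i i
        · exact Or.inl ⟨tau u w.length i, fst_tau _ _,
            (word_eq_iff.mpr (h1.trans hP)).trans hi.symm⟩
        · refine Or.inr ⟨tau u w.length i, ⟨fst_tau _ _, fun h2 => hP ?_⟩,
            (word_rev_iff.mpr h1).trans hi.symm⟩
          exact h1.symm.transE (h2.trans h1)
    · rintro (⟨t, _, rfl⟩ | ⟨t, _, rfl⟩)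
      · exact ⟨by simp, isFactor_word _ _⟩
      · exact ⟨by simp, hcur _ (isFactor_word _ _)⟩
  · rw [Set.disjoint_left]
    rintro _ ⟨t, ht, rfl⟩ ⟨s, ⟨hs, hs'⟩, h⟩
    have := word_rev_iff.mp h
    have hst := Fst.inj hs ht (Or.inr this)
    subst hst
    exact hs' this
  · intro s hs t ht h
    exact Fst.inj hs.1 ht.1 (Or.inl (word_eq_iff.mp (List.reverse_injective h)))
  · intro s hs t ht h
    exact Fst.inj hs ht (Or.inl (word_eq_iff.mp h))

lemma fst_succ_ncard [Finite A] (u : ℕ → A) (n : ℕ) :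
    {t | Fst u n t}.ncard = {t | Fst u n (t + 1)}.ncard + 1 := by
  have hinj : Function.Injective (fun t : ℕ => t + 1) := fun a b h => by simpa using h
  have : {t | Fst u n t} = insert 0 ((fun t => t + 1) '' {t | Fst u n (t + 1)}) := by
    ext t
    cases t with
    | zero => simp [Fst]
    | succ t => simp
  have hfin : {t | Fst u n (t + 1)}.Finite :=
    Set.Finite.of_finite_image ((fst_finite u n).subset (by
      rintro _ ⟨t, ht, rfl⟩; exact ht)) hinj.injOn
  rw [this, Set.ncard_insert_of_notMem (by simp) (hfin.image _),
    Set.ncard_image_of_injective _ hinj]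

lemma newEdge_iff [Finite A] (hcur : ClosedUnderReversal u) :
    NewEdge u ↔ ∀ n, complexity u (n + 1) + 2 =
      complexity u n + palComplexity u n + palComplexity u (n + 1) := by
  have key : ∀ n, (complexity u (n + 1) + 2 =
      complexity u n + palComplexity u n + palComplexity u (n + 1)) ↔
      {t | Fst u (n + 1) t ∧ ¬ WR u (n + 1) t t}.ncard = {t | Fst u n (t + 1)}.ncard := by
    intro n
    rw [complexity_eq hcur, complexity_eq hcur, palComplexity_eq, palComplexity_eq]
    have h1 := fst_ncard u n
    have h2 := fst_ncard u (n + 1)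
    have h3 := fst_succ_ncard u n
    omega
  have hsub : ∀ n, {t | Fst u n (t + 1)} ⊆ {t | Fst u (n + 1) t ∧ ¬ WR u (n + 1) t t} :=
    fun n t ht => Fst.pred ht
  constructor
  · intro h n
    rw [key]
    congr 1
    exact Set.Subset.antisymm (fun t ht => h n t ht.1 ht.2) (hsub n)
  · intro h n t h1 h2
    have := Set.eq_of_subset_of_ncard_le (hsub n) ((key n).mp (h n)).le
      ((fst_finite u (n + 1)).subset (fun t h => h.1))
    have h3 : t ∈ {t | Fst u (n + 1) t ∧ ¬ WR u (n + 1) t t} := ⟨h1, h2⟩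
    rw [← this] at h3
    exact h3

lemma rich_iff [Finite A] (hcur : ClosedUnderReversal u) :
    Rich u ↔ ∀ n, complexity u (n + 1) + 2 =
      complexity u n + palComplexity u n + palComplexity u (n + 1) :=
  Iff.trans ⟨fun h => h.palRet.newEdge, fun h => h.rich⟩ (newEdge_iff hcur)

end Counting

section Telescope

set_option linter.unusedSectionVars false

variable {A : Type*} {u : ℕ → A}

lemma sum_fiber {α β : Type*} (S : Finset α) (T : Set β) (hT : T.Finite) (f : β → α)
    (hf : ∀ v ∈ T, f v ∈ S) :
    ∑ w ∈ S, ({v | v ∈ T ∧ f v = w}.ncard : ℤ) = T.ncard := by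
  classical
  have h1 : T.ncard = hT.toFinset.card := Set.ncard_eq_toFinset_card T hT
  rw [h1, Finset.card_eq_sum_card_fiberwise (s := hT.toFinset) (t := S) (f := f)
    (fun v hv => hf v (by simpa using hv))]
  push_cast
  refine Finset.sum_congr rfl (fun w _ => ?_)
  congr 1
  rw [← Set.ncard_coe_finset]
  congr 1; ext v; simp

lemma IsFactor.of_isInfix {v w : List A} (h : IsFactor u w) (hv : v <:+: w) : IsFactor u v := by
  obtain ⟨i, hi⟩ := h
  rw [OccursAt] at hi
  rw [hi] at hv
  obtain ⟨j, m, _, _, rfl⟩ := infix_word_iff.mp hv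
  exact isFactor_word _ _

lemma dropLast_isInfix (v : List A) : v.dropLast <:+: v := by
  rcases List.eq_nil_or_concat v with rfl | ⟨m, b, rfl⟩
  · simp
  · exact ⟨[], [b], by simp⟩

lemma word_cons (t n : ℕ) : word u t (n + 1) = u t :: word u (t + 1) n := by
  rw [add_comm n 1, word_add]; simp [word]

lemma word_snoc (t n : ℕ) : word u t (n + 1) = word u t n ++ [u (t + n)] := by
  rw [word_add]; simp [word]

lemma word_ext (t n : ℕ) :
    word u t (n + 2) = u t :: (word u (t + 1) n ++ [u (t + 1 + n)]) := by
  rw [word_cons, word_snoc]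

lemma exists_ends {n : ℕ} {v : List A} (h : v.length = n + 2) :
    ∃ a m b, v = a :: (m ++ [b]) ∧ m.length = n := by
  cases v with
  | nil => simp at h
  | cons a v =>
    rcases List.eq_nil_or_concat v with rfl | ⟨m, b, rfl⟩
    · simp at h
    · exact ⟨a, m, b, by simp, by simpa using h⟩

lemma rext_nonempty {w : List A} (hw : IsFactor u w) : (Rext u w).Nonempty := by
  obtain ⟨i, hi⟩ := hw
  rw [OccursAt] at hi
  refine ⟨u (i + w.length), ?_⟩
  have := isFactor_word (u := u) i (w.length + 1)
  rw [word_snoc, ← hi] at this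
  exact this

lemma mem_lext_iff (hcur : ClosedUnderReversal u) {w : List A} {a : A} :
    a ∈ Lext u w ↔ a ∈ Rext u w.reverse := by
  constructor
  · intro h
    have := hcur _ h
    simpa [Rext] using this
  · intro h
    have := hcur _ h
    simpa [Lext] using this

lemma lext_nonempty (hcur : ClosedUnderReversal u) {w : List A} (hw : IsFactor u w) :
    (Lext u w).Nonempty := by
  obtain ⟨a, ha⟩ := rext_nonempty (hcur _ hw)
  exact ⟨a, (mem_lext_iff hcur).mpr ha⟩

open Classical in
/-- the local defect of a factor -/
noncomputable def defect (u : ℕ → A) (w : List A) : ℤ :=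
  bilateralOrder u w - if w.reverse = w then ((Pext u w).ncard : ℤ) - 1 else 0

variable [Finite A]

lemma sum_rext (n : ℕ) : ∑ w ∈ (factors_finite u n).toFinset, ((Rext u w).ncard : ℤ) =
    complexity u (n + 1) := by
  rw [complexity, ← sum_fiber (factors_finite u n).toFinset _ (factors_finite u (n + 1))
    List.dropLast]
  · refine Finset.sum_congr rfl (fun w hw => ?_)
    simp only [Set.Finite.mem_toFinset, Set.mem_ofPred_eq] at hw
    congr 1
    rw [← Set.ncard_image_of_injective (f := fun b => w ++ [b]) (Rext u w)
      (fun a b h => by simpa using h)]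
    congr 1
    ext v
    constructor
    · rintro ⟨b, hb, rfl⟩
      exact ⟨⟨by simp [hw.1], hb⟩, by simp⟩
    · rintro ⟨⟨h1, h2⟩, h3⟩
      rcases List.eq_nil_or_concat v with rfl | ⟨m, b, rfl⟩
      · simp at h1
      · simp at h3
        subst h3
        exact ⟨b, by simpa [Rext] using h2, by simp⟩
  · rintro v ⟨h1, h2⟩
    simp only [Set.Finite.mem_toFinset, Set.mem_ofPred_eq]
    exact ⟨by simp [h1], h2.of_isInfix (dropLast_isInfix v)⟩

lemma sum_lext (n : ℕ) : ∑ w ∈ (factors_finite u n).toFinset, ((Lext u w).ncard : ℤ) =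
    complexity u (n + 1) := by
  rw [complexity, ← sum_fiber (factors_finite u n).toFinset _ (factors_finite u (n + 1))
    List.tail]
  · refine Finset.sum_congr rfl (fun w hw => ?_)
    simp only [Set.Finite.mem_toFinset, Set.mem_ofPred_eq] at hw
    congr 1
    rw [← Set.ncard_image_of_injective (f := fun b => b :: w) (Lext u w)
      (fun a b h => by simpa using h)]
    congr 1
    ext v
    constructor
    · rintro ⟨b, hb, rfl⟩
      exact ⟨⟨by simp [hw.1], hb⟩, by simp⟩
    · rintro ⟨⟨h1, h2⟩, h3⟩
      cases v with
      | nil => simp at h1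
      | cons b m =>
        simp at h3
        subst h3
        exact ⟨b, h2, rfl⟩
  · rintro v ⟨h1, h2⟩
    simp only [Set.Finite.mem_toFinset, Set.mem_ofPred_eq]
    exact ⟨by simp [h1], h2.of_isInfix (List.tail_suffix v).isInfix⟩

lemma inner_isFac (a b : A) (m : List A) : m <:+: a :: (m ++ [b]) := ⟨[a], [b], by simp⟩

lemma bext_inj (w : List A) :
    Function.Injective (fun p : A × A => p.1 :: (w ++ [p.2])) := by
  rintro ⟨a, b⟩ ⟨c, d⟩ h
  simpa using h

lemma sum_bext (n : ℕ) : ∑ w ∈ (factors_finite u n).toFinset, ((Bext u w).ncard : ℤ) =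
    complexity u (n + 2) := by
  rw [complexity, ← sum_fiber (factors_finite u n).toFinset _ (factors_finite u (n + 2))
    (fun v => v.tail.dropLast)]
  · refine Finset.sum_congr rfl (fun w hw => ?_)
    simp only [Set.Finite.mem_toFinset, Set.mem_ofPred_eq] at hw
    congr 1
    rw [← Set.ncard_image_of_injective (Bext u w) (bext_inj w)]
    congr 1
    ext v
    constructor
    · rintro ⟨b, hb, rfl⟩
      exact ⟨⟨by simp [hw.1], hb⟩, by simp⟩
    · rintro ⟨⟨h1, h2⟩, h3⟩
      obtain ⟨a, m, b, rfl, hm⟩ := exists_ends h1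
      simp at h3
      subst h3
      exact ⟨(a, b), h2, rfl⟩
  · rintro v ⟨h1, h2⟩
    simp only [Set.Finite.mem_toFinset, Set.mem_ofPred_eq]
    obtain ⟨a, m, b, rfl, hm⟩ := exists_ends h1
    simp only [List.tail_cons, List.dropLast_concat]
    exact ⟨hm, h2.of_isInfix (inner_isFac a b m)⟩

lemma palFactors_finite (u : ℕ → A) (n : ℕ) :
    {w : List A | w.length = n ∧ IsFactor u w ∧ w.reverse = w}.Finite :=
  (factors_finite u n).subset (fun _ h => ⟨h.1, h.2.1⟩)

lemma sum_pext (n : ℕ) : ∑ w ∈ (palFactors_finite u n).toFinset, ((Pext u w).ncard : ℤ) =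
    palComplexity u (n + 2) := by
  rw [palComplexity, ← sum_fiber (palFactors_finite u n).toFinset _ (palFactors_finite u (n + 2))
    (fun v => v.tail.dropLast)]
  · refine Finset.sum_congr rfl (fun w hw => ?_)
    simp only [Set.Finite.mem_toFinset, Set.mem_ofPred_eq] at hw
    congr 2
    ext v
    constructor
    · rintro ⟨b, rfl, hb⟩
      exact ⟨⟨by simp [hw.1], hb, by simp [hw.2.2]⟩, by simp⟩
    · rintro ⟨⟨h1, h2, h4⟩, h3⟩
      obtain ⟨a, m, b, rfl, hm⟩ := exists_ends h1
      simp at h3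
      subst h3
      have : b = a := by simp at h4; exact h4.1
      subst this
      exact ⟨b, rfl, h2⟩
  · rintro v ⟨h1, h2, h4⟩
    simp only [Set.Finite.mem_toFinset, Set.mem_ofPred_eq]
    obtain ⟨a, m, b, rfl, hm⟩ := exists_ends h1
    simp only [List.tail_cons, List.dropLast_concat]
    refine ⟨hm, h2.of_isInfix (inner_isFac a b m), ?_⟩
    have : b = a := by simp at h4; exact h4.1
    subst this
    simpa using h4

lemma sum_defect (n : ℕ) : ∑ w ∈ (factors_finite u n).toFinset, defect u w =
    (complexity u (n + 2) : ℤ) - 2 * complexity u (n + 1) + complexity u n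
      - (palComplexity u (n + 2) - palComplexity u n) := by
  classical
  have h1 : (complexity u n : ℤ) = ∑ w ∈ (factors_finite u n).toFinset, 1 := by
    rw [complexity, Set.ncard_eq_toFinset_card _ (factors_finite u n)]; simp
  have h2 : (palComplexity u n : ℤ) = ∑ w ∈ (palFactors_finite u n).toFinset, 1 := by
    rw [palComplexity, Set.ncard_eq_toFinset_card _ (palFactors_finite u n)]; simp
  have h3 : (factors_finite u n).toFinset.filter (fun w => w.reverse = w) =
      (palFactors_finite u n).toFinset := by
    ext w; simp [and_assoc]
  simp only [defect, bilateralOrder, Finset.sum_sub_distrib, Finset.sum_add_distrib, sum_bext,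
    sum_rext, sum_lext]
  rw [← Finset.sum_filter, h3, Finset.sum_sub_distrib, sum_pext, ← h1, ← h2]
  ring

lemma complexity_zero : complexity u 0 = 1 := by
  have : {w : List A | w.length = 0 ∧ IsFactor u w} = {[]} := by
    ext w
    constructor
    · rintro ⟨h, _⟩; simpa using h
    · rintro rfl; exact ⟨rfl, 0, by simp [OccursAt, word]⟩
  rw [complexity, this]; simp

lemma palComplexity_zero : palComplexity u 0 = 1 := by
  have : {w : List A | w.length = 0 ∧ IsFactor u w ∧ w.reverse = w} = {[]} := by
    ext w
    constructor
    · rintro ⟨h, _⟩; simpa using h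
    · rintro rfl; exact ⟨rfl, ⟨0, by simp [OccursAt, word]⟩, rfl⟩
  rw [palComplexity, this]; simp

lemma palComplexity_one : palComplexity u 1 = complexity u 1 := by
  rw [palComplexity, complexity]
  congr 1
  ext w
  constructor
  · rintro ⟨h, h', _⟩; exact ⟨h, h'⟩
  · rintro ⟨h, h'⟩
    obtain ⟨a, rfl⟩ := List.length_eq_one_iff.mp h
    exact ⟨h, h', rfl⟩

lemma balance_iff : (∀ n, complexity u (n + 1) + 2 =
      complexity u n + palComplexity u n + palComplexity u (n + 1)) ↔
    ∀ n, ∑ w ∈ (factors_finite u n).toFinset, defect u w = 0 := by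
  constructor
  · intro h n
    rw [sum_defect]
    have h1 := h n
    have h2 := h (n + 1)
    rw [add_assoc n 1 1] at h2
    norm_num at h2
    omega
  · intro h n
    induction n with
    | zero =>
      rw [zero_add, complexity_zero, palComplexity_zero, palComplexity_one]; omega
    | succ n ih =>
      have h1 := h n
      rw [sum_defect] at h1
      rw [add_assoc n 1 1]
      norm_num
      omega

lemma lext_eq_rext (hcur : ClosedUnderReversal u) {w : List A} (hp : w.reverse = w) :
    Lext u w = Rext u w := by
  ext a
  rw [mem_lext_iff hcur, hp]

lemma bext_fst_mem {w : List A} {p : A × A} (h : p ∈ Bext u w) : p.1 ∈ Lext u w :=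
  IsFactor.of_isInfix h (List.prefix_append (p.1 :: w) [p.2]).isInfix

lemma bext_snd_mem {w : List A} {p : A × A} (h : p ∈ Bext u w) : p.2 ∈ Rext u w :=
  IsFactor.of_isInfix h (List.suffix_cons p.1 (w ++ [p.2])).isInfix

lemma exists_bext_right (hcur : ClosedUnderReversal u) {w : List A} {b : A}
    (h : b ∈ Rext u w) : ∃ a, (a, b) ∈ Bext u w := lext_nonempty hcur h

lemma exists_bext_left {w : List A} {a : A}
    (h : a ∈ Lext u w) : ∃ b, (a, b) ∈ Bext u w := rext_nonempty h

lemma bext_ncard_of_lext (hcur : ClosedUnderReversal u) {w : List A} {a : A}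
    (h : Lext u w = {a}) : (Bext u w).ncard = (Rext u w).ncard := by
  rw [← Set.ncard_image_of_injective (f := fun b => (a, b)) (Rext u w)
    (fun x y h => by simpa using h)]
  congr 1
  ext ⟨x, y⟩
  constructor
  · intro hp
    have h1 := bext_fst_mem hp
    rw [h] at h1
    exact ⟨y, bext_snd_mem hp, by rw [show x = a from h1]⟩
  · rintro ⟨b, hb, he⟩
    obtain ⟨c, hc⟩ := exists_bext_right hcur hb
    have h1 := bext_fst_mem hc
    rw [h] at h1
    rw [← he, ← show c = a from h1]
    exact hc

lemma bext_ncard_of_rext {w : List A} {a : A}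
    (h : Rext u w = {a}) : (Bext u w).ncard = (Lext u w).ncard := by
  rw [← Set.ncard_image_of_injective (f := fun b => (b, a)) (Lext u w)
    (fun x y h => by simpa using h)]
  congr 1
  ext ⟨x, y⟩
  constructor
  · intro hp
    have h1 := bext_snd_mem hp
    rw [h] at h1
    exact ⟨x, bext_fst_mem hp, by rw [show y = a from h1]⟩
  · rintro ⟨b, hb, he⟩
    obtain ⟨c, hc⟩ := exists_bext_left hb
    have h1 := bext_snd_mem hc
    rw [h] at h1
    rw [← he, ← show c = a from h1]
    exact hc

lemma pext_ncard (w : List A) : (Pext u w).ncard = {a | (a, a) ∈ Bext u w}.ncard := by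
  rw [← Set.ncard_image_of_injective (f := fun a => a :: (w ++ [a])) {a | (a, a) ∈ Bext u w}
    (fun x y h => by simpa using h)]
  congr 1
  ext v
  constructor
  · rintro ⟨a, rfl, h⟩; exact ⟨a, h, rfl⟩
  · rintro ⟨a, h, rfl⟩; exact ⟨a, rfl, h⟩

lemma defect_of_not_bispecial (hcur : ClosedUnderReversal u) {w : List A} (hw : IsFactor u w)
    (h : ¬ Bispecial u w) : defect u w = 0 := by
  have hl : 0 < (Lext u w).ncard := (Set.ncard_pos (Set.toFinite _)).mpr (lext_nonempty hcur hw)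
  have hr : 0 < (Rext u w).ncard := (Set.ncard_pos (Set.toFinite _)).mpr (rext_nonempty hw)
  have hor : (Lext u w).ncard = 1 ∨ (Rext u w).ncard = 1 := by
    by_contra hcon
    push Not at hcon
    exact h ⟨hw, by omega, by omega⟩
  have hb : bilateralOrder u w = 0 := by
    rw [bilateralOrder]
    rcases hor with h1 | h1
    · obtain ⟨a, ha⟩ := Set.ncard_eq_one.mp h1
      rw [bext_ncard_of_lext hcur ha, h1]; simp
    · obtain ⟨a, ha⟩ := Set.ncard_eq_one.mp h1
      rw [bext_ncard_of_rext ha, h1]; simp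
  rw [defect, hb]
  split_ifs with hp
  · have he := lext_eq_rext hcur hp
    rw [he] at hor
    obtain ⟨a, ha⟩ := Set.ncard_eq_one.mp (or_self_iff.mp hor)
    have : {b | (b, b) ∈ Bext u w} = {a} := by
      ext b
      constructor
      · intro hb
        have := bext_snd_mem hb
        rwa [ha] at this
      · rintro rfl
        have h1 : b ∈ Rext u w := by rw [ha]; rfl
        obtain ⟨c, hc⟩ := exists_bext_right hcur h1
        have := bext_fst_mem hc
        rw [he, ha] at this
        rw [show c = b from this] at hc
        exact hc
    rw [pext_ncard, this]; simp
  · simp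

lemma defect_eq_zero_iff (w : List A) : defect u w = 0 ↔
    (w.reverse ≠ w → bilateralOrder u w = 0) ∧
      (w.reverse = w → bilateralOrder u w = (Set.ncard (Pext u w) : ℤ) - 1) := by
  rw [defect]
  split_ifs with hp
  · simp [hp, sub_eq_zero]
  · simp [hp]

end Telescope

section LocalPart

variable {A : Type*} {u : ℕ → A}

lemma walk_tree {V : Type*} (p : ℕ → V) : ∃ (f : V → ℕ) (g : V → V),
    ∀ v ∈ Set.range p, v ≠ p 0 → (∃ k, p k = g v ∧ p (k + 1) = v) ∧ f (g v) < f v := by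
  classical
  let f : V → ℕ := fun v => if h : ∃ k, p k = v then Nat.find h else 0
  refine ⟨f, fun v => p (f v - 1), ?_⟩
  rintro v ⟨k, hk⟩ hv
  have hex : ∃ k, p k = v := ⟨k, hk⟩
  have hf : f v = Nat.find hex := dif_pos hex
  have hs : p (f v) = v := by rw [hf]; exact Nat.find_spec hex
  have hpos : f v ≠ 0 := by
    intro h0; rw [h0] at hs; exact hv hs.symm
  refine ⟨⟨f v - 1, rfl, by rw [show f v - 1 + 1 = f v by omega, hs]⟩, ?_⟩
  have hex2 : ∃ k, p k = p (f v - 1) := ⟨_, rfl⟩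
  have hf2 : f (p (f v - 1)) = Nat.find hex2 := dif_pos hex2
  have := Nat.find_min' hex2 rfl
  show f (p (f v - 1)) < f v
  omega

lemma recurrent (hcur : ClosedUnderReversal u) (n i N : ℕ) : ∃ t, N ≤ t ∧ WE u n i t := by
  induction N with
  | zero => exact ⟨i, by omega, WE.refl _ _⟩
  | succ N ih =>
    obtain ⟨t, ht, hE⟩ := ih
    obtain ⟨c, r, hr⟩ := lext_nonempty hcur (isFactor_word (u := u) 0 (t + n))
    rw [OccursAt, List.length_cons, word_length, word_cons] at hr
    have h1 := (List.cons.inj hr).2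
    rw [word_eq_iff] at h1
    refine ⟨r + 1 + t, by omega, hE.trans ?_⟩
    have := h1.sub (d := t) (m := n) (by omega)
    rwa [zero_add] at this

/-- Enumeration of the occurrences of a class with the palindromic return property. -/
lemma exists_enum (hcur : ClosedUnderReversal u) (hP : PalRet u) (n i : ℕ) :
    ∃ s : ℕ → ℕ, (∀ k, 1 ≤ s k ∧ WS u n i (s k)) ∧
      (∀ k, WR u n (s k) (s (k + 1)) ∧ u (s k + n) = u (s (k + 1) - 1)) ∧
      (∀ t, 1 ≤ t → WS u n i t → ∃ k, s k = t) := by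
  classical
  let q : ℕ → Prop := fun t => 1 ≤ t ∧ WS u n i t
  have hinf : {t | q t}.Infinite := by
    rw [Set.infinite_iff_exists_gt]
    intro N
    obtain ⟨t, ht, hE⟩ := recurrent hcur n i (N + 1)
    exact ⟨t, ⟨by omega, Or.inl hE⟩, by omega⟩
  have hmem : ∀ k, q (Nat.nth q k) := fun k => Nat.nth_mem_of_infinite hinf k
  refine ⟨Nat.nth q, hmem, ?_, ?_⟩
  · intro k
    have hlt : Nat.nth q k < Nat.nth q (k + 1) := (Nat.nth_lt_nth hinf).mpr (by omega)
    have hret := hP n _ _ hlt ((hmem k).2.symm.trans (hmem (k + 1)).2) (by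
      intro l h1 h2 h3
      have hq : q l := ⟨by omega, (hmem k).2.trans h3⟩
      have := Nat.lt_nth_iff_count_lt hinf (p := q) (a := k + 1) (b := l)
      have h4 := Nat.nth_count hq
      rw [← h4] at h1 h2
      rw [Nat.nth_lt_nth hinf] at h1 h2
      omega)
    constructor
    · have h1 := hret.sub (m := n) (d := 0) (e := Nat.nth q (k + 1) - Nat.nth q k) (by omega)
      rwa [add_zero, show Nat.nth q k + (Nat.nth q (k + 1) - Nat.nth q k) = Nat.nth q (k + 1)
        by omega] at h1
    · rw [hret n (Nat.nth q (k + 1) - Nat.nth q k - 1) (by omega)]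
      congr 1; omega
  · intro t h1 h2
    have : t ∈ Set.range (Nat.nth q) := by
      rw [Nat.range_nth_of_infinite hinf]; exact ⟨h1, h2⟩
    exact this

lemma mem_bext_of_we {n i t : ℕ} (ht : 1 ≤ t) (h : WE u n i t) :
    (u (t - 1), u (t + n)) ∈ Bext u (word u i n) := by
  have := isFactor_word (u := u) (t - 1) (n + 2)
  rw [word_ext, show t - 1 + 1 = t by omega, ← word_eq_iff.mpr h] at this
  exact this

lemma mem_bext_of_wr (hcur : ClosedUnderReversal u) {n i t : ℕ} (ht : 1 ≤ t) (h : WR u n i t) :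
    (u (t + n), u (t - 1)) ∈ Bext u (word u i n) := by
  have := hcur _ (isFactor_word (u := u) (t - 1) (n + 2))
  rw [word_ext, show t - 1 + 1 = t by omega, ← word_rev_iff.mpr h] at this
  simpa [Bext] using this

lemma exists_occ_of_lext {n i : ℕ} {a : A} (h : a ∈ Lext u (word u i n)) :
    ∃ t, 1 ≤ t ∧ WE u n i t ∧ u (t - 1) = a := by
  obtain ⟨r, hr⟩ := h
  rw [OccursAt, List.length_cons, word_length, word_cons] at hr
  obtain ⟨h1, h2⟩ := List.cons.inj hr
  exact ⟨r + 1, by omega, word_eq_iff.mp h2, h1.symm⟩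

lemma exists_occ_of_rext (hcur : ClosedUnderReversal u) {n i : ℕ} {a : A}
    (h : a ∈ Rext u (word u i n)) :
    ∃ t, 1 ≤ t ∧ WR u n i t ∧ u (t - 1) = a := by
  obtain ⟨r, hr⟩ := hcur _ h
  rw [OccursAt] at hr
  simp only [List.reverse_append, List.reverse_cons, List.reverse_nil, List.nil_append,
    List.cons_append, List.length_cons, List.length_reverse, word_length] at hr
  rw [word_cons] at hr
  obtain ⟨h1, h2⟩ := List.cons.inj hr
  exact ⟨r + 1, by omega, word_rev_iff.mp h2, h1.symm⟩

variable [Finite A]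

lemma defect_nonneg_pal (hcur : ClosedUnderReversal u) (hP : PalRet u) (n i : ℕ)
    (hpal : WR u n i i) :
    (Pext u (word u i n)).ncard + 2 * (Lext u (word u i n)).ncard ≤
      (Bext u (word u i n)).ncard + 2 := by
  classical
  obtain ⟨s, hs1, hs2, hs3⟩ := exists_enum hcur hP n i
  have hE : ∀ k, WE u n i (s k) := fun k => (hs1 k).2.elim id (fun h => hpal.trans h)
  let p : ℕ → A := fun k => u (s k - 1)
  obtain ⟨f, g, hfg⟩ := walk_tree p
  have hLp : Lext u (word u i n) ⊆ Set.range p := by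
    intro a ha
    obtain ⟨t, ht1, ht2, ht3⟩ := exists_occ_of_lext ha
    obtain ⟨k, hk⟩ := hs3 t ht1 (Or.inl ht2)
    exact ⟨k, by simp only [p, hk, ht3]⟩
  have hp0 : p 0 ∈ Lext u (word u i n) := bext_fst_mem (mem_bext_of_we (hs1 0).1 (hE 0))
  set T := Lext u (word u i n) \ {p 0} with hT
  have hTc : T.ncard + 1 = (Lext u (word u i n)).ncard :=
    Set.ncard_sdiff_singleton_add_one hp0 (Set.toFinite _)
  have hTg : ∀ v ∈ T, (g v, v) ∈ Bext u (word u i n) ∧ (v, g v) ∈ Bext u (word u i n) ∧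
      f (g v) < f v := by
    rintro v ⟨hv1, hv2⟩
    obtain ⟨⟨k, hk1, hk2⟩, hlt⟩ := hfg v (hLp hv1) hv2
    have e2 : u (s k + n) = v := (hs2 k).2.trans hk2
    have e1 : u (s k - 1) = g v := hk1
    have b1 := mem_bext_of_we (hs1 k).1 (hE k)
    have b2 := mem_bext_of_wr hcur (hs1 k).1 (hpal.transE (hE k))
    rw [e1, e2] at b1 b2
    exact ⟨b1, b2, hlt⟩
  rw [pext_ncard, ← hTc]
  set D := {a | (a, a) ∈ Bext u (word u i n)} with hD
  have c1 : ((fun a => (a, a)) '' D).ncard = D.ncard :=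
    Set.ncard_image_of_injective _ (fun x y h => by simpa using h)
  have c2 : ((fun a => (g a, a)) '' T).ncard = T.ncard :=
    Set.ncard_image_of_injective _ (fun x y h => by simp at h; exact h.2)
  have c3 : ((fun a => (a, g a)) '' T).ncard = T.ncard :=
    Set.ncard_image_of_injective _ (fun x y h => by simp at h; exact h.1)
  have d1 : Disjoint ((fun a => (a, a)) '' D) ((fun a => (g a, a)) '' T) := by
    rw [Set.disjoint_left]
    rintro _ ⟨a, _, rfl⟩ ⟨b, hb, h⟩
    have h0 := (hTg b hb).2.2
    have h1 : g b = a := congrArg Prod.fst h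
    have h2 : b = a := congrArg Prod.snd h
    rw [h1, h2] at h0; omega
  have d2 : Disjoint ((fun a => (a, a)) '' D ∪ (fun a => (g a, a)) '' T)
      ((fun a => (a, g a)) '' T) := by
    rw [Set.disjoint_left]
    rintro _ (⟨a, _, rfl⟩ | ⟨a, ha, rfl⟩) ⟨b, hb, h⟩
    · have h0 := (hTg b hb).2.2
      have h1 : b = a := congrArg Prod.fst h
      have h2 : g b = a := congrArg Prod.snd h
      rw [h2, h1] at h0; omega
    · have h0 := (hTg b hb).2.2
      have h0' := (hTg a ha).2.2
      have h1 : b = g a := congrArg Prod.fst h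
      have h2 : g b = a := congrArg Prod.snd h
      rw [h2, h1] at h0; omega
  have hle := Set.ncard_le_ncard (s := ((fun a => (a, a)) '' D ∪ (fun a => (g a, a)) '' T) ∪
      ((fun a => (a, g a)) '' T)) (t := Bext u (word u i n)) (by
    rintro _ ((⟨a, ha, rfl⟩ | ⟨a, ha, rfl⟩) | ⟨a, ha, rfl⟩)
    · exact ha
    · exact (hTg a ha).1
    · exact (hTg a ha).2.1) (Set.toFinite _)
  rw [Set.ncard_union_eq d2 (Set.toFinite _) (Set.toFinite _),
    Set.ncard_union_eq d1 (Set.toFinite _) (Set.toFinite _), c1, c2, c3] at hle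
  omega

lemma defect_nonneg_nonpal (hcur : ClosedUnderReversal u) (hP : PalRet u) (n i : ℕ)
    (hpal : ¬ WR u n i i) :
    (Lext u (word u i n)).ncard + (Rext u (word u i n)).ncard ≤
      (Bext u (word u i n)).ncard + 1 := by
  classical
  obtain ⟨s, hs1, hs2, hs3⟩ := exists_enum hcur hP n i
  have hex : ∀ t, WE u n i t → WR u n i t → False :=
    fun t h1 h2 => hpal (h2.transE h1.symm)
  let p : ℕ → Bool × A := fun k => (decide (WE u n i (s k)), u (s k - 1))
  obtain ⟨f, g, hfg⟩ := walk_tree p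
  set V : Set (Bool × A) := (fun a => (true, a)) '' Lext u (word u i n) ∪
    (fun a => (false, a)) '' Rext u (word u i n) with hV
  have hVc : V.ncard = (Lext u (word u i n)).ncard + (Rext u (word u i n)).ncard := by
    rw [hV, Set.ncard_union_eq _ (Set.toFinite _) (Set.toFinite _),
      Set.ncard_image_of_injective _ (fun x y h => by simpa using h),
      Set.ncard_image_of_injective _ (fun x y h => by simpa using h)]
    rw [Set.disjoint_left]
    rintro _ ⟨a, _, rfl⟩ ⟨b, _, h⟩
    simp at h
  have hVp : V ⊆ Set.range p := by
    rintro _ (⟨a, ha, rfl⟩ | ⟨a, ha, rfl⟩)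
    · obtain ⟨t, ht1, ht2, ht3⟩ := exists_occ_of_lext ha
      obtain ⟨k, hk⟩ := hs3 t ht1 (Or.inl ht2)
      exact ⟨k, by simp only [p, hk, ht3, ht2, decide_true]⟩
    · obtain ⟨t, ht1, ht2, ht3⟩ := exists_occ_of_rext hcur ha
      obtain ⟨k, hk⟩ := hs3 t ht1 (Or.inr ht2)
      have : ¬ WE u n i t := fun h => hex t h ht2
      exact ⟨k, by simp only [p, hk, ht3, this, decide_false]⟩
  -- the edge of a vertex
  let e : Bool × A → A × A := fun v => if v.1 then (v.2, (g v).2) else ((g v).2, v.2)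
  have hstep : ∀ v ∈ V \ {p 0}, e v ∈ Bext u (word u i n) ∧ (g v).1 = !v.1 ∧ f (g v) < f v := by
    rintro v ⟨hv1, hv2⟩
    obtain ⟨⟨k, hk1, hk2⟩, hlt⟩ := hfg v (hVp hv1) hv2
    refine ⟨?_, ?_, hlt⟩
    · have h2 := (hs2 k).2
      by_cases hE : WE u n i (s k)
      · have hE' : ¬ WE u n i (s (k + 1)) := fun h => hex _ h (hE.transR (hs2 k).1)
        have := mem_bext_of_we (hs1 k).1 hE
        have a1 : v.1 = false := by rw [← hk2]; simp [p, hE']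
        have a2 : v.2 = u (s (k + 1) - 1) := by rw [← hk2]
        have a3 : (g v).2 = u (s k - 1) := by rw [← hk1]
        simp only [e, a1, a2, a3]
        rw [h2] at this
        simpa using this
      · have hR : WR u n i (s k) := (hs1 k).2.resolve_left hE
        have hE' : WE u n i (s (k + 1)) := hR.trans (hs2 k).1
        have := mem_bext_of_wr hcur (hs1 k).1 hR
        have a1 : v.1 = true := by rw [← hk2]; simp [p, hE']
        have a2 : v.2 = u (s (k + 1) - 1) := by rw [← hk2]
        have a3 : (g v).2 = u (s k - 1) := by rw [← hk1]
        simp only [e, a1, a2, a3]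
        rw [h2] at this
        simpa using this
    · rw [← hk1, ← hk2]
      simp only [p]
      by_cases hE : WE u n i (s k)
      · have hE' : ¬ WE u n i (s (k + 1)) := fun h => hex _ h (hE.transR (hs2 k).1)
        simp [hE, hE']
      · have hR : WR u n i (s k) := (hs1 k).2.resolve_left hE
        have hE' : WE u n i (s (k + 1)) := hR.trans (hs2 k).1
        simp [hE, hE']
  have hinj : Set.InjOn e (V \ {p 0}) := by
    intro v hv w hw h
    have hv' := hstep v hv
    have hw' := hstep w hw
    obtain ⟨bv, av⟩ := v
    obtain ⟨bw, aw⟩ := w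
    rcases hgv : g (bv, av) with ⟨cv, dv⟩
    rcases hgw : g (bw, aw) with ⟨cw, dw⟩
    simp only [e, hgv, hgw] at h hv' hw'
    obtain ⟨_, hv1, hv2⟩ := hv'
    obtain ⟨_, hw1, hw2⟩ := hw'
    cases bv <;> cases bw <;> simp at h hv1 hw1 <;> obtain ⟨rfl, rfl⟩ := h <;> subst hv1 hw1
    · rfl
    · omega
    · omega
    · rfl
  have hle := Set.ncard_le_ncard_of_injOn e (fun v hv => (hstep v hv).1) hinj (Set.toFinite _)
  have : V.ncard ≤ (V \ {p 0}).ncard + 1 := by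
    have := Set.le_ncard_sdiff {p 0} V
    rw [Set.ncard_singleton] at this
    omega
  omega

lemma defect_nonneg (hcur : ClosedUnderReversal u) (hP : PalRet u) {w : List A}
    (hw : IsFactor u w) : 0 ≤ defect u w := by
  obtain ⟨i, hi⟩ := hw
  rw [OccursAt] at hi
  by_cases hp : WR u w.length i i
  · have h1 := defect_nonneg_pal hcur hP _ _ hp
    rw [← hi] at h1
    have hp' : w.reverse = w := by
      have := word_rev_iff.mpr hp
      rwa [← hi] at this
    rw [defect, bilateralOrder, if_pos hp', ← lext_eq_rext hcur hp']
    omega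
  · have h1 := defect_nonneg_nonpal hcur hP _ _ hp
    rw [← hi] at h1
    have hp' : ¬ w.reverse = w := by
      intro h
      apply hp
      apply word_rev_iff.mp
      rw [← hi, h]
    rw [defect, bilateralOrder, if_neg hp']
    omega

end LocalPart

/-- If the language of `u` is closed under reversal, then `u` is
rich iff every bispecial factor `w` satisfies: `b(w) = 0` when `w` is
non-palindromic, and `b(w) = #Pext(w) − 1` when `w` is a palindrome. -/
theorem stmt8 {A : Type*} [Fintype A] (u : ℕ → A)
    (hall : AllLettersOccur u)
    (hcur : ClosedUnderReversal u) :
    Rich u ↔ ∀ w : List A, Bispecial u w →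
      (w.reverse ≠ w → bilateralOrder u w = 0) ∧
      (w.reverse = w → bilateralOrder u w = (Set.ncard (Pext u w) : ℤ) - 1) := by
  constructor
  · intro h w hw
    rw [← defect_eq_zero_iff]
    have hsum := balance_iff.mp ((rich_iff hcur).mp h) w.length
    rw [Finset.sum_eq_zero_iff_of_nonneg] at hsum
    · exact hsum w (by simpa using hw.1)
    · intro v hv
      simp only [Set.Finite.mem_toFinset, Set.mem_ofPred_eq] at hv
      exact defect_nonneg hcur h.palRet hv.2
  · intro h
    rw [rich_iff hcur, balance_iff]
    intro n
    refine Finset.sum_eq_zero (fun w hw => ?_)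
    simp only [Set.Finite.mem_toFinset, Set.mem_ofPred_eq] at hw
    by_cases hb : Bispecial u w
    · exact (defect_eq_zero_iff w).mpr (h w hb)
    · exact defect_of_not_bispecial hcur hw.2 hb
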